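/- A mapping ρ : 𝒳 × 𝒴 → ℝ satisfies conditions M, CA, IC, N and LI if and only if there exists a law-invariant family of monotone functionals {G_W : W ∈ 𝒴} that are in addition continuous from below (f_n ∈ D*, f_n ↑ f pointwise implies G_W(f_n) → G_W(f)) such that ρ(X, W) = ∫₀^∞ G_W(1 − F_{X|W=·}(x)) dx + ∫_{−∞}^0 (G_W(1 − F_{X|W=·}(x)) − 1) dx for all X ∈ 𝒳 and W ∈ 𝒴. -/

import Mathlib

open MeasureTheory ProbabilityTheory Set Filter

noncomputable section

/-- The probability measure `P` is atomless. -/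
def Atomless {Ω : Type*} [MeasurableSpace Ω] (P : Measure Ω) : Prop :=
  ∀ A : Set Ω, MeasurableSet A → 0 < P A →
    ∃ B, B ⊆ A ∧ MeasurableSet B ∧ 0 < P B ∧ P B < P A

/-- A bounded (measurable) random variable, i.e. a member of `𝒳 = L^∞`. -/
def BddRV {Ω : Type*} [MeasurableSpace Ω] (X : Ω → ℝ) : Prop :=
  Measurable X ∧ ∃ C : ℝ, ∀ ω, |X ω| ≤ C

/-- Two random variables are comonotonic. -/
def Comonotonic {Ω : Type*} (X₁ X₂ : Ω → ℝ) : Prop :=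
  ∃ (Z : Ω → ℝ) (f₁ f₂ : ℝ → ℝ), Monotone f₁ ∧ Monotone f₂ ∧
    (∀ x, f₁ x + f₂ x = x) ∧ (∀ ω, X₁ ω = f₁ (Z ω)) ∧ (∀ ω, X₂ ω = f₂ (Z ω))

/-- `K` is a Markov-kernel version of the conditional distribution of `X` given `W`. -/
def IsCondDistrib {Ω : Type*} [MeasurableSpace Ω] {N : ℕ} (P : Measure Ω)
    (X : Ω → ℝ) (W : Ω → (Fin N → ℝ)) (K : Kernel (Fin N → ℝ) ℝ) : Prop :=
  IsMarkovKernel K ∧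
    ∀ B : Set ℝ, MeasurableSet B → ∀ S : Set (Fin N → ℝ), MeasurableSet S →
      P ({ω | X ω ∈ B} ∩ W ⁻¹' S) = ∫⁻ w in S, K w B ∂(P.map W)

/-- Membership in `D*`: Borel measurable functions `ℝ^N → [0,1]`. -/
def InDstar {N : ℕ} (f : (Fin N → ℝ) → ℝ) : Prop :=
  Measurable f ∧ ∀ w, f w ∈ Icc (0:ℝ) 1

/-- A monotone distortion functional on `D*` (monotone w.r.t. the `μ`-a.e. order). -/
def MonotoneFunctional {N : ℕ} (μ : Measure (Fin N → ℝ))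
    (G : ((Fin N → ℝ) → ℝ) → ℝ) : Prop :=
  (∀ f, InDstar f → G f ∈ Icc (0:ℝ) 1) ∧
  G (fun _ => 0) = 0 ∧ G (fun _ => 1) = 1 ∧
  ∀ f g, InDstar f → InDstar g → (∀ᵐ w ∂μ, g w ≤ f w) → G g ≤ G f

/-- `G` is continuous from below: `fₙ ↑ f` pointwise implies `G fₙ → G f`. -/
def ContinuousFromBelow {N : ℕ} (G : ((Fin N → ℝ) → ℝ) → ℝ) : Prop :=
  ∀ (f : ℕ → (Fin N → ℝ) → ℝ) (g : (Fin N → ℝ) → ℝ),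
    (∀ n, InDstar (f n)) → InDstar g → (∀ w, Monotone fun n => f n w) →
    (∀ w, Tendsto (fun n => f n w) atTop (nhds (g w))) →
    Tendsto (fun n => G (f n)) atTop (nhds (G g))

/-- The distortion factor risk measure value. -/
def distortionRM {N : ℕ} (G : ((Fin N → ℝ) → ℝ) → ℝ) (K : Kernel (Fin N → ℝ) ℝ) : ℝ :=
  (∫ x in Ioi (0:ℝ), G (fun w => 1 - (K w (Iic x)).toReal)) +
  (∫ x in Iio (0:ℝ), ((G (fun w => 1 - (K w (Iic x)).toReal)) - 1))


/-- collision mass -/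
lemma exists_nonatomic {Ω : Type*} [MeasurableSpace Ω] (P : Measure Ω) [IsProbabilityMeasure P]
    (hat : Atomless P) : ∃ V : Ω → ℝ, Measurable V ∧ ∀ x, P (V ⁻¹' {x}) = 0 := by
  classical
  let D : (Ω → ℝ) → Set (Ω × Ω) := fun V => {p | V p.1 = V p.2}
  let T : Set ENNReal := {c | ∃ V : Ω → ℝ, Measurable V ∧ (P.prod P) (D V) = c}
  have hTne : T.Nonempty := ⟨_, fun _ => 0, measurable_const, rfl⟩
  obtain ⟨u, -, hu, huT⟩ := exists_seq_tendsto_sInf hTne (OrderBot.bddBelow T)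
  choose V hV hVu using huT
  let e := embeddingReal (ℕ → ℝ)
  have he : MeasurableEmbedding e := measurableEmbedding_embeddingReal _
  let V0 : Ω → ℝ := fun ω => e (fun n => V n ω)
  have hV0 : Measurable V0 := he.measurable.comp (measurable_pi_lambda _ hV)
  have hle : (P.prod P) (D V0) ≤ sInf T := by
    refine ge_of_tendsto' hu fun n => ?_
    rw [← hVu n]
    refine measure_mono fun p hp => ?_
    have := he.injective hp
    exact congrFun this n
  refine ⟨V0, hV0, fun x => ?_⟩
  by_contra hx
  obtain ⟨B, hBA, hB, hB0, hBlt⟩ := hat (V0 ⁻¹' {x}) (hV0 (measurableSet_singleton x))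
    (pos_iff_ne_zero.2 hx)
  let e2 := embeddingReal (ℝ × ℝ)
  have he2 : MeasurableEmbedding e2 := measurableEmbedding_embeddingReal _
  let V1 : Ω → ℝ := fun ω => e2 (V0 ω, B.indicator (fun _ => (1:ℝ)) ω)
  have hV1 : Measurable V1 :=
    he2.measurable.comp (hV0.prodMk (measurable_const.indicator hB))
  have hDm : ∀ V : Ω → ℝ, Measurable V → MeasurableSet (D V) := fun V hV =>
    measurableSet_eq_fun (hV.comp measurable_fst) (hV.comp measurable_snd)
  have hA := hV0 (measurableSet_singleton x)
  have hdis : Disjoint (D V1) (B ×ˢ ((V0 ⁻¹' {x}) \ B)) := by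
    rw [Set.disjoint_left]
    rintro ⟨a, b⟩ h1 ⟨h2, h3⟩
    have := he2.injective h1
    have h4 := congrArg Prod.snd this
    simp only [Set.mem_sdiff] at h2 h3
    simp [h2, h3.2] at h4
  have hsub : D V1 ∪ (B ×ˢ ((V0 ⁻¹' {x}) \ B)) ⊆ D V0 := by
    rintro ⟨a, b⟩ (h | ⟨h1, h2⟩)
    · exact congrArg Prod.fst (he2.injective h)
    · exact (hBA h1).trans (h2.1).symm
  have h1 := measure_mono (μ := P.prod P) hsub
  rw [measure_union hdis (hB.prod (hA.diff hB)), Measure.prod_prod] at h1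
  have h2 : sInf T ≤ (P.prod P) (D V1) := sInf_le ⟨V1, hV1, rfl⟩
  have h3 : P (V0 ⁻¹' {x} \ B) ≠ 0 := by
    rw [measure_sdiff hBA hB.nullMeasurableSet (measure_ne_top _ _)]
    exact (tsub_pos_of_lt hBlt).ne'
  have h4 : (P.prod P) (D V1) + P B * P (V0 ⁻¹' {x} \ B) ≤ (P.prod P) (D V1) + 0 := by
    rw [add_zero]; exact h1.trans (hle.trans h2)
  have h5 := (ENNReal.add_le_add_iff_left (measure_ne_top _ _)).1 h4
  exact (mul_ne_zero hB0.ne' h3) (le_antisymm h5 zero_le)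

lemma exists_uniform {Ω : Type*} [MeasurableSpace Ω] (P : Measure Ω) [IsProbabilityMeasure P]
    (hat : Atomless P) : ∃ U : Ω → unitInterval, Measurable U ∧ P.map U = volume := by
  obtain ⟨V, hV, hV0⟩ := exists_nonatomic P hat
  let m := P.map V
  have : IsProbabilityMeasure m := Measure.isProbabilityMeasure_map hV.aemeasurable
  have hm0 : ∀ x, m {x} = 0 := fun x => by
    rw [Measure.map_apply hV (measurableSet_singleton x)]; exact hV0 x
  let F := cdf m
  have hFm : Measurable F := (monotone_cdf m).measurable
  have hFc : Continuous F := by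
    rw [continuous_iff_continuousAt]
    intro x
    rw [(monotone_cdf m).continuousAt_iff_leftLim_eq_rightLim, StieltjesFunction.rightLim_eq]
    have h := F.measure_singleton x
    rw [show F.measure = m from measure_cdf m, hm0] at h
    have h' := ENNReal.ofReal_eq_zero.1 h.symm
    have := (monotone_cdf m).leftLim_le (le_refl x)
    change Function.leftLim F x ≤ F x at this
    change Function.leftLim F x = F x
    linarith
  have hsurj : ∀ t : ℝ, 0 < t → t < 1 → ∃ v, F v = t := by
    intro t h0 h1
    obtain ⟨a, ha⟩ := ((tendsto_cdf_atBot m).eventually_lt_const h0).exists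
    obtain ⟨b, hb⟩ := ((tendsto_cdf_atTop m).eventually_const_lt h1).exists
    exact mem_range_of_exists_le_of_exists_ge hFc ⟨a, ha.le⟩ ⟨b, hb.le⟩
  let U : Ω → unitInterval := fun ω => ⟨F (V ω), cdf_nonneg m _, cdf_le_one m _⟩
  have hU : Measurable U := (hFm.comp hV).subtype_mk
  refine ⟨U, hU, ?_⟩
  have : IsProbabilityMeasure (P.map U) := Measure.isProbabilityMeasure_map hU.aemeasurable
  refine Measure.ext_of_Iic _ _ fun t => ?_
  rw [Measure.map_apply hU measurableSet_Iic, unitInterval.volume_Iic]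
  have hPF : ∀ v, P {ω | V ω ≤ v} = ENNReal.ofReal (F v) := fun v => by
    rw [ofReal_cdf m, Measure.map_apply hV measurableSet_Iic]; rfl
  apply le_antisymm
  · rcases eq_or_lt_of_le t.2.2 with h1 | h1
    · rw [h1]; simp [prob_le_one]
    · have : ∀ s : ℝ, (t:ℝ) < s → s < 1 → P (U ⁻¹' Iic t) ≤ ENNReal.ofReal s := by
        intro s hs hs1
        obtain ⟨v, hv⟩ := hsurj s (t.2.1.trans_lt hs) hs1
        rw [← hv, ← hPF]
        refine measure_mono fun ω hω => ?_
        have hω' : F (V ω) ≤ t := hω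
        by_contra hh
        simp only [mem_ofPred_eq, not_le] at hh
        have := monotone_cdf m hh.le
        change F v ≤ F (V ω) at this
        linarith
      have ht : Tendsto (fun s : ℝ => ENNReal.ofReal s) (nhdsWithin (t:ℝ) (Ioi (t:ℝ)))
          (nhds (ENNReal.ofReal t)) :=
        (ENNReal.continuous_ofReal.tendsto _).mono_left nhdsWithin_le_nhds
      refine ge_of_tendsto ht ?_
      filter_upwards [Ioo_mem_nhdsGT h1] with s hs using this s hs.1 hs.2
  · rcases eq_or_lt_of_le t.2.1 with h0 | h0
    · rw [← h0]; simp
    rcases eq_or_lt_of_le t.2.2 with h1 | h1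
    · have : U ⁻¹' Iic t = univ := by
        ext ω
        simp only [mem_preimage, mem_Iic, mem_univ, iff_true]
        change ((U ω : ℝ)) ≤ t
        rw [h1]; exact (U ω).2.2
      rw [this, h1]; simp
    · obtain ⟨v, hv⟩ := hsurj t h0 h1
      rw [← hv, ← hPF]
      refine measure_mono fun ω hω => ?_
      change F (V ω) ≤ t
      rw [← hv]
      exact monotone_cdf m hω

lemma exists_pair {Ω : Type*} [MeasurableSpace Ω] (P : Measure Ω) [IsProbabilityMeasure P]
    (hat : Atomless P) {N : ℕ} (μ : Measure (Fin N → ℝ)) [IsProbabilityMeasure μ] :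
    ∃ (W : Ω → (Fin N → ℝ)) (U : Ω → ℝ), Measurable W ∧ Measurable U ∧
      P.map (fun ω => (W ω, U ω)) = μ.prod (volume.restrict (Icc (0:ℝ) 1)) := by
  obtain ⟨U, hU, hUm⟩ := exists_uniform P hat
  have : IsProbabilityMeasure (volume.restrict (Icc (0:ℝ) 1)) := ⟨by simp⟩
  obtain ⟨f, hf, hfm⟩ := Measure.exists_measurable_map_eq (μ.prod (volume.restrict (Icc (0:ℝ) 1)))
  refine ⟨fun ω => (f (U ω)).1, fun ω => (f (U ω)).2, (hf.comp hU).fst, (hf.comp hU).snd, ?_⟩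
  rw [← hfm, ← hUm, Measure.map_map hf hU]
  rfl

lemma chq_formula (g : ℝ → ℝ) (hg : Antitone g) (M : ℝ) (hM : 0 ≤ M) (h1 : ∀ x, x < -M → g x = 1)
    (h0 : ∀ x, M ≤ x → g x = 0) :
    (∫ x in Ioi (0:ℝ), g x) + (∫ x in Iio (0:ℝ), (g x - 1)) = (∫ y in (0:ℝ)..(2*M), g (y - M)) - M := by
  have hii : ∀ a b, IntervalIntegrable g volume a b := fun a b => hg.intervalIntegrable
  have e1 : (∫ x in Ioi (0:ℝ), g x) = ∫ x in (0:ℝ)..M, g x := by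
    rw [intervalIntegral.integral_of_le hM]
    apply setIntegral_eq_of_subset_of_forall_sdiff_eq_zero measurableSet_Ioi
      Ioc_subset_Ioi_self
    rintro x ⟨hx, hx'⟩
    apply h0
    simp only [mem_Ioc, mem_Ioi, not_and, not_le] at hx hx'
    exact (hx' hx).le
  have e2 : (∫ x in Iio (0:ℝ), (g x - 1)) = ∫ x in (-M)..(0:ℝ), (g x - 1) := by
    rw [intervalIntegral.integral_of_le (by linarith), ← integral_Icc_eq_integral_Ioc,
      integral_Icc_eq_integral_Ico]
    apply setIntegral_eq_of_subset_of_forall_sdiff_eq_zero measurableSet_Iio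
      Ico_subset_Iio_self
    rintro x ⟨hx, hx'⟩
    rw [h1, sub_self]
    simp only [mem_Ico, mem_Iio, not_and, not_lt] at hx hx'
    by_contra hh
    exact absurd (hx' (not_lt.1 hh)) (not_le.2 hx)
  rw [e1, e2, intervalIntegral.integral_sub (hii _ _) intervalIntegrable_const,
    intervalIntegral.integral_comp_sub_right (fun x => g x) M,
    ← intervalIntegral.integral_add_adjacent_intervals (hii (0 - M) 0) (hii 0 (2*M - M))]
  simp only [intervalIntegral.integral_const, smul_eq_mul, zero_sub]
  rw [show 2*M - M = M by ring]
  ring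

/-- Greco type representation. -/
lemma greco {Ω : Type*} [MeasurableSpace Ω] (P : Measure Ω) 
    (φ : (Ω → ℝ) → ℝ)
    (hM : ∀ X Y, BddRV X → BddRV Y → (∀ᵐ ω ∂P, X ω ≤ Y ω) → φ X ≤ φ Y)
    (hCA : ∀ X₁ X₂, BddRV X₁ → BddRV X₂ → Comonotonic X₁ X₂ → φ (X₁ + X₂) = φ X₁ + φ X₂)
    (hN : φ (fun _ => 1) = 1) (X : Ω → ℝ) (hX : BddRV X) :
    φ X = (∫ x in Ioi (0:ℝ), φ ({ω | x < X ω}.indicator fun _ => 1)) +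
      (∫ x in Iio (0:ℝ), (φ ({ω | x < X ω}.indicator fun _ => 1) - 1)) := by
  have hconst : ∀ c : ℝ, BddRV (fun _ : Ω => c) := fun c => ⟨measurable_const, |c|, fun _ => le_rfl⟩
  have hadd : ∀ X Y : Ω → ℝ, BddRV X → BddRV Y → BddRV (X + Y) := by
    rintro X Y ⟨hX, C, hC⟩ ⟨hY, D, hD⟩
    exact ⟨hX.add hY, C + D, fun ω => (abs_add_le _ _).trans (add_le_add (hC ω) (hD ω))⟩
  have hind : ∀ (Y : Ω → ℝ), Measurable Y → ∀ x, BddRV ({ω | x < Y ω}.indicator fun _ => (1:ℝ)) := by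
    intro Y hY x
    refine ⟨measurable_const.indicator (measurableSet_lt measurable_const hY), 1, fun ω => ?_⟩
    by_cases h : ω ∈ {ω | x < Y ω} <;> simp [indicator, h]
  have hcm : ∀ (Y : Ω → ℝ) (c : ℝ), Comonotonic Y (fun _ => c) := fun Y c =>
    ⟨fun ω => Y ω + c, fun z => z - c, fun _ => c, fun a b h => by simpa using h,
      monotone_const, fun x => by ring, fun ω => by ring, fun ω => rfl⟩
  have hc0 : φ (fun _ => 0) = 0 := by
    have := hCA (fun _ => 0) (fun _ => 0) (hconst 0) (hconst 0) (hcm _ _)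
    have e : ((fun _ => 0 : Ω → ℝ) + fun _ => 0) = fun _ => 0 := by ext; simp
    rw [e] at this; linarith
  have hcn : ∀ n : ℕ, φ (fun _ => (n:ℝ)) = n := by
    intro n
    induction n with
    | zero => simpa using hc0
    | succ n ih =>
      have := hCA (fun _ => (n:ℝ)) (fun _ => 1) (hconst _) (hconst 1) (hcm _ _)
      rw [ih, hN] at this
      push_cast
      exact this
  have hsm : ∀ (Y : Ω → ℝ), BddRV Y → ∀ n : ℕ, BddRV (fun ω => (n:ℝ) * Y ω) ∧
      φ (fun ω => (n:ℝ) * Y ω) = n * φ Y := by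
    intro Y hY n
    induction n with
    | zero => simpa using ⟨hconst 0, hc0⟩
    | succ n ih =>
      have hco : Comonotonic (fun ω => (n:ℝ) * Y ω) Y := by
        have hp : (0:ℝ) < n + 1 := by positivity
        refine ⟨fun ω => (n + 1) * Y ω, fun z => n / (n+1) * z, fun z => 1 / (n+1) * z, ?_, ?_, ?_,
          ?_, ?_⟩
        · intro a b h; dsimp only; gcongr
        · intro a b h; dsimp only; gcongr
        · intro x; field_simp
        · intro ω; field_simp
        · intro ω; field_simp
      have e : (fun ω => ((n+1 : ℕ):ℝ) * Y ω) = (fun ω => (n:ℝ) * Y ω) + Y := by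
        ext ω; simp; ring
      rw [e]
      refine ⟨hadd _ _ ih.1 hY, ?_⟩
      rw [hCA _ _ ih.1 hY hco, ih.2]; push_cast; ring
  -- antitone survival function
  have hanti : ∀ (Y : Ω → ℝ), Measurable Y →
      Antitone (fun x => φ ({ω | x < Y ω}.indicator fun _ => 1)) := by
    intro Y hY a b hab
    refine hM _ _ (hind Y hY b) (hind Y hY a) (Eventually.of_forall fun ω => ?_)
    refine indicator_le_indicator_of_subset (fun ω (h : b < Y ω) => lt_of_le_of_lt hab h)
      (fun _ => zero_le_one) ω
  have h01 : ∀ (Y : Ω → ℝ), Measurable Y → ∀ x, 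
      0 ≤ φ ({ω | x < Y ω}.indicator fun _ => 1) ∧ φ ({ω | x < Y ω}.indicator fun _ => 1) ≤ 1 := by
    intro Y hY x
    constructor
    · rw [← hc0]
      exact hM _ _ (hconst 0) (hind Y hY x) (Eventually.of_forall fun ω => 
        indicator_nonneg (fun _ _ => zero_le_one) ω)
    · refine le_of_le_of_eq ?_ hN
      exact hM _ _ (hind Y hY x) (hconst 1) (Eventually.of_forall fun ω => 
        indicator_le_self' (fun _ _ => zero_le_one) ω)
  -- layer estimate
  have hlayer : ∀ (Y : Ω → ℝ), Measurable Y → ∀ M : ℕ, (∀ ω, 0 ≤ Y ω ∧ Y ω ≤ M) →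
      |φ Y - ∫ x in (0:ℝ)..M, φ ({ω | x < Y ω}.indicator fun _ => 1)| ≤ 1 := by
    intro Y hY M hYM
    set g : ℝ → ℝ := fun x => φ ({ω | x < Y ω}.indicator fun _ => 1) with hg
    have hmin : ∀ k : ℕ, BddRV (fun ω => min (Y ω) k) := fun k =>
      ⟨hY.min measurable_const, k, fun ω => by
        rw [abs_of_nonneg (le_min (hYM ω).1 (Nat.cast_nonneg k))]; exact min_le_right _ _⟩
    have hstep : ∀ k : ℕ, g (k+1) ≤ φ (fun ω => min (Y ω) (k+1 : ℕ)) - φ (fun ω => min (Y ω) k) ∧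
        φ (fun ω => min (Y ω) (k+1 : ℕ)) - φ (fun ω => min (Y ω) k) ≤ g k := by
      intro k
      let L : Ω → ℝ := fun ω => max (min (Y ω) (k+1 : ℕ) - k) 0
      have hL01 : ∀ ω, 0 ≤ L ω ∧ L ω ≤ 1 := fun ω => 
        ⟨le_max_right _ _, max_le (by have := min_le_right (Y ω) ((k+1 : ℕ):ℝ); push_cast at this ⊢; linarith) zero_le_one⟩
      have hL : BddRV L := ⟨((hY.min measurable_const).sub measurable_const).max measurable_const, 1,
        fun ω => by rw [abs_of_nonneg (hL01 ω).1]; exact (hL01 ω).2⟩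
      have hsum : (fun ω => min (Y ω) (k+1 : ℕ)) = (fun ω => min (Y ω) k) + L := by
        ext ω
        simp only [Pi.add_apply, L]
        push_cast
        rcases le_total (Y ω) k with h | h
        · rw [min_eq_left h, min_eq_left (by linarith), max_eq_right (by linarith)]; ring
        · rw [min_eq_right h, max_eq_left]
          · ring
          · have : (k:ℝ) ≤ min (Y ω) (k+1) := le_min h (by linarith)
            linarith
      have hco : Comonotonic (fun ω => min (Y ω) k) L := by
        refine ⟨fun ω => min (Y ω) (k+1 : ℕ), fun z => min z k, fun z => max (z - k) 0, ?_, ?_, ?_,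
          ?_, ?_⟩
        · intro a b h; exact min_le_min_right _ h
        · intro a b h; exact max_le_max_right _ (by linarith)
        · intro x
          rcases le_total x k with h | h
          · simp [h]
          · simp [h]
        · intro ω
          push_cast
          rw [min_assoc, min_eq_right (a := (k:ℝ)+1) (by linarith)]
        · intro ω; rfl
      rw [hsum, hCA _ _ (hmin k) hL hco, add_sub_cancel_left]
      constructor
      · refine hM _ _ (hind Y hY _) hL (Eventually.of_forall fun ω => ?_)
        by_cases h : (k:ℝ) + 1 < Y ω
        · simp [indicator, h, L, h.le]
        · simp [indicator, h, L]
      · refine hM _ _ hL (hind Y hY _) (Eventually.of_forall fun ω => ?_)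
        by_cases h : (k:ℝ) < Y ω
        · simpa [indicator, h] using (hL01 ω).2
        · simp only [not_lt] at h
          simp [indicator, not_lt.2 h, L, h]
    have hmin0 : φ (fun ω => min (Y ω) ((0:ℕ):ℝ)) = 0 := by
      rw [← hc0]; congr 1; ext ω; simp [(hYM ω).1]
    have hminM : (fun ω => min (Y ω) (M:ℝ)) = Y := by
      ext ω; simp [(hYM ω).2]
    have htel := Finset.sum_range_sub (fun k : ℕ => φ (fun ω => min (Y ω) (k:ℝ))) M
    simp only [hmin0, hminM, sub_zero] at htel
    have u1 : φ Y ≤ ∑ k ∈ Finset.range M, g k := by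
      rw [← htel]; exact Finset.sum_le_sum fun k _ => (hstep k).2
    have u2 : ∑ k ∈ Finset.range M, g ((k+1 : ℕ)) ≤ φ Y := by
      rw [← htel]; exact Finset.sum_le_sum fun k _ => by push_cast; exact_mod_cast (hstep k).1
    have v1 := AntitoneOn.integral_le_sum (x₀ := 0) (a := M) (f := g) ((hanti Y hY).antitoneOn _)
    have v2 := AntitoneOn.sum_le_integral (x₀ := 0) (a := M) (f := g) ((hanti Y hY).antitoneOn _)
    simp only [zero_add] at v1 v2
    have w := Finset.sum_range_sub (fun k : ℕ => g k) M
    rw [Finset.sum_sub_distrib] at w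
    have g0 := h01 Y hY ((0:ℕ):ℝ)
    have gM := h01 Y hY (M:ℝ)
    rw [abs_le]
    constructor <;> linarith [g0.1, g0.2, gM.1, gM.2]
  have hpos : ∀ (Y : Ω → ℝ), Measurable Y → ∀ M : ℕ, (∀ ω, 0 ≤ Y ω ∧ Y ω ≤ M) →
      φ Y = ∫ x in (0:ℝ)..M, φ ({ω | x < Y ω}.indicator fun _ => 1) := by
    intro Y hY M hYM
    have hYb : BddRV Y := ⟨hY, M, fun ω => by rw [abs_of_nonneg (hYM ω).1]; exact (hYM ω).2⟩
    have key : ∀ n : ℕ, |φ Y - ∫ x in (0:ℝ)..M, φ ({ω | x < Y ω}.indicator fun _ => 1)|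
        ≤ 1 / ((n:ℝ) + 1) := by
      intro n
      have hp : (0:ℝ) < n + 1 := by positivity
      have h := hlayer (fun ω => ((n+1 : ℕ):ℝ) * Y ω) (hsm Y hYb (n+1)).1.1 ((n+1) * M) (fun ω => by
        push_cast
        exact ⟨mul_nonneg hp.le (hYM ω).1, mul_le_mul_of_nonneg_left (hYM ω).2 hp.le⟩)
      rw [(hsm Y hYb (n+1)).2] at h
      have e : ∀ x : ℝ, {ω | x < ((n+1 : ℕ):ℝ) * Y ω} = {ω | x / ((n:ℝ)+1) < Y ω} := by
        intro x; ext ω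
        simp only [mem_ofPred_eq]
        rw [div_lt_iff₀ hp]; push_cast; rw [mul_comm]
      simp_rw [e] at h
      rw [intervalIntegral.integral_comp_div
        (fun x => φ ({ω | x < Y ω}.indicator fun _ => 1)) hp.ne'] at h
      push_cast at h
      rw [zero_div, mul_div_cancel_left₀ _ hp.ne', smul_eq_mul, ← mul_sub, abs_mul,
        abs_of_pos hp] at h
      rw [le_div_iff₀ hp]; linarith
    have := ge_of_tendsto' tendsto_one_div_add_atTop_nhds_zero_nat key
    have := abs_eq_zero.1 (le_antisymm this (abs_nonneg _))
    linarith
  obtain ⟨hXm, C, hC⟩ := hX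
  obtain ⟨M, hMC⟩ := exists_nat_ge C
  have hX' : ∀ ω, -(M:ℝ) ≤ X ω ∧ X ω ≤ M := fun ω => abs_le.1 ((hC ω).trans hMC)
  have hY : φ (X + fun _ => (M:ℝ)) = φ X + M := by
    rw [hCA _ _ ⟨hXm, C, hC⟩ (hconst _) (hcm _ _), hcn]
  have := hpos (X + fun _ => (M:ℝ)) (hXm.add measurable_const) (2 * M) (fun ω => by
    simp only [Pi.add_apply]; push_cast
    constructor <;> linarith [(hX' ω).1, (hX' ω).2])
  rw [chq_formula (fun x => φ ({ω | x < X ω}.indicator fun _ => 1)) (hanti X hXm) M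
    (Nat.cast_nonneg M)]
  · have e : ∀ x, {ω | x < (X + fun _ : Ω => (M:ℝ)) ω} = {ω | x - M < X ω} := by
      intro x; ext ω; simp [sub_lt_iff_lt_add]
    simp_rw [e] at this
    push_cast at this
    linarith
  · intro x hx
    have : {ω | x < X ω} = univ := by
      ext ω; simp; linarith [(hX' ω).1]
    simp only [this, indicator_univ]; exact hN
  · intro x hx
    have : {ω | x < X ω} = ∅ := by
      ext ω; simp; linarith [(hX' ω).2]
    simp only [this, indicator_empty]; exact hc0

lemma openUpper (s : Set ℝ) (ho : IsOpen s) (hu : ∀ a b, a ≤ b → a ∈ s → b ∈ s) :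
    s = ∅ ∨ s = univ ∨ ∃ t, s = Ioi t := by
  rcases s.eq_empty_or_nonempty with h | hne
  · exact Or.inl h
  right
  by_cases hb : BddBelow s
  · right
    refine ⟨sInf s, ?_⟩
    ext z
    constructor
    · intro hz
      refine lt_of_le_of_ne (csInf_le hb hz) fun hEq => ?_
      obtain ⟨y, hy, hy'⟩ := exists_Ioc_subset_of_mem_nhds (ho.mem_nhds hz) ⟨z - 1, by linarith⟩
      have : (y + z) / 2 ∈ s := hy' ⟨by linarith, by linarith⟩
      have := csInf_le hb this
      linarith
    · intro hz
      obtain ⟨y, hy, hyz⟩ := exists_lt_of_csInf_lt hne hz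
      exact hu _ _ hyz.le hy
  · left
    rw [not_bddBelow_iff] at hb
    ext z
    simp only [mem_univ, iff_true]
    obtain ⟨y, hy, hyz⟩ := hb z
    exact hu _ _ hyz.le hy

/-- Choquet integral. -/
def chq {Ω : Type*} (ν : Set Ω → ℝ) (X : Ω → ℝ) : ℝ :=
  (∫ x in Ioi (0:ℝ), ν {ω | x < X ω}) + (∫ x in Iio (0:ℝ), (ν {ω | x < X ω} - 1))

lemma cap_anti {Ω : Type*} [MeasurableSpace Ω] (P : Measure Ω) (ν : Set Ω → ℝ)
    (hm : ∀ A B, MeasurableSet A → MeasurableSet B → (∀ᵐ ω ∂P, ω ∈ A → ω ∈ B) → ν A ≤ ν B)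
    (X : Ω → ℝ) (hX : Measurable X) : Antitone (fun x => ν {ω | x < X ω}) := by
  intro a b hab
  exact hm _ _ (measurableSet_lt measurable_const hX) (measurableSet_lt measurable_const hX)
    (Eventually.of_forall fun ω (h : b < X ω) => lt_of_le_of_lt hab h)

lemma chq_eq {Ω : Type*} [MeasurableSpace Ω] (P : Measure Ω) (ν : Set Ω → ℝ)
    (h0 : ν ∅ = 0) (h1 : ν univ = 1)
    (hm : ∀ A B, MeasurableSet A → MeasurableSet B → (∀ᵐ ω ∂P, ω ∈ A → ω ∈ B) → ν A ≤ ν B)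
    (X : Ω → ℝ) (hX : Measurable X) (M : ℝ) (hM0 : 0 ≤ M) (hM : ∀ ω, |X ω| ≤ M) :
    chq ν X = (∫ y in (0:ℝ)..(2*M), ν {ω | y - M < X ω}) - M := by
  refine chq_formula (fun x => ν {ω | x < X ω}) (cap_anti P ν hm X hX) M hM0 ?_ ?_
  · intro x hx
    have : {ω | x < X ω} = univ := by
      ext ω; simp; linarith [(abs_le.1 (hM ω)).1]
    simp only [this, h1]
  · intro x hx
    have : {ω | x < X ω} = ∅ := by
      ext ω; simp; linarith [(abs_le.1 (hM ω)).2]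
    simp only [this, h0]

lemma chq_mono {Ω : Type*} [MeasurableSpace Ω] (P : Measure Ω) (ν : Set Ω → ℝ)
    (h0 : ν ∅ = 0) (h1 : ν univ = 1)
    (hm : ∀ A B, MeasurableSet A → MeasurableSet B → (∀ᵐ ω ∂P, ω ∈ A → ω ∈ B) → ν A ≤ ν B)
    (X Y : Ω → ℝ) (hX : BddRV X) (hY : BddRV Y) (hXY : ∀ᵐ ω ∂P, X ω ≤ Y ω) :
    chq ν X ≤ chq ν Y := by
  obtain ⟨hXm, C, hC⟩ := hX
  obtain ⟨hYm, D, hD⟩ := hY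
  let M := max (max C D) 0
  have hM0 : 0 ≤ M := le_max_right _ _
  rw [chq_eq P ν h0 h1 hm X hXm M hM0 fun ω => (hC ω).trans ((le_max_left _ _).trans (le_max_left _ _)),
    chq_eq P ν h0 h1 hm Y hYm M hM0 fun ω => (hD ω).trans ((le_max_right _ _).trans (le_max_left _ _))]
  have hi : ∀ X : Ω → ℝ, Measurable X →
      IntervalIntegrable (fun y => ν {ω | y - M < X ω}) volume 0 (2*M) := by
    intro X hX
    apply Antitone.intervalIntegrable
    intro a b hab
    exact cap_anti P ν hm X hX (sub_le_sub_right hab M)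
  have := intervalIntegral.integral_mono_on (by linarith) (hi X hXm) (hi Y hYm) (fun y _ => 
    hm _ _ (measurableSet_lt measurable_const hXm) (measurableSet_lt measurable_const hYm)
      (by filter_upwards [hXY] with ω hω h using lt_of_lt_of_le h hω))
  linarith

lemma chq_indicator {Ω : Type*} (ν : Set Ω → ℝ)
    (h0 : ν ∅ = 0) (h1 : ν univ = 1) (A : Set Ω) :
    chq ν (A.indicator fun _ => 1) = ν A := by
  unfold chq
  have e1 : (∫ x in Ioi (0:ℝ), ν {ω | x < A.indicator (fun _ => (1:ℝ)) ω}) = ν A := by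
    have : (∫ x in Ioi (0:ℝ), ν {ω | x < A.indicator (fun _ => (1:ℝ)) ω})
        = ∫ x in Ioi (0:ℝ), (Iio (1:ℝ)).indicator (fun _ => ν A) x := by
      refine setIntegral_congr_fun measurableSet_Ioi fun x hx => ?_
      have hx : 0 < x := hx
      by_cases h : x < 1
      · have : {ω | x < A.indicator (fun _ => (1:ℝ)) ω} = A := by
          ext ω; by_cases hω : ω ∈ A <;> simp [hω, h, hx.le]
        simp [this, h]
      · have : {ω | x < A.indicator (fun _ => (1:ℝ)) ω} = ∅ := by
          ext ω; by_cases hω : ω ∈ A <;> simp [hω, hx.le, not_lt.1 h]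
        simp [this, h, h0]
    rw [this, setIntegral_indicator measurableSet_Iio, Ioi_inter_Iio]
    simp
  have e2 : (∫ x in Iio (0:ℝ), (ν {ω | x < A.indicator (fun _ => (1:ℝ)) ω} - 1)) = 0 := by
    have : (∫ x in Iio (0:ℝ), (ν {ω | x < A.indicator (fun _ => (1:ℝ)) ω} - 1))
        = ∫ x in Iio (0:ℝ), (0:ℝ) := by
      refine setIntegral_congr_fun measurableSet_Iio fun x hx => ?_
      have hx : x < 0 := hx
      have : {ω | x < A.indicator (fun _ => (1:ℝ)) ω} = univ := by
        ext ω; by_cases hω : ω ∈ A <;> simp [hω, hx]; linarith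
      simp [this, h1]
    rw [this]; simp
  rw [e1, e2, add_zero]

lemma chq_CA {Ω : Type*} [MeasurableSpace Ω] (P : Measure Ω) (ν : Set Ω → ℝ)
    (h0 : ν ∅ = 0) (h1 : ν univ = 1)
    (hm : ∀ A B, MeasurableSet A → MeasurableSet B → (∀ᵐ ω ∂P, ω ∈ A → ω ∈ B) → ν A ≤ ν B)
    (hc : ∀ A : ℕ → Set Ω, (∀ n, MeasurableSet (A n)) → Monotone A →
      Tendsto (fun n => ν (A n)) atTop (nhds (ν (⋃ n, A n))))
    (X₁ X₂ : Ω → ℝ) (hX₁ : BddRV X₁) (hX₂ : BddRV X₂) (hco : Comonotonic X₁ X₂) :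
    chq ν (X₁ + X₂) = chq ν X₁ + chq ν X₂ := by
  obtain ⟨Z, f₁, f₂, hf₁, hf₂, hf, hZ₁, hZ₂⟩ := hco
  have hZe : Z = X₁ + X₂ := by ext ω; simp [hZ₁, hZ₂, hf]
  obtain ⟨hX₁m, C, hC⟩ := hX₁
  obtain ⟨hX₂m, D, hD⟩ := hX₂
  have hZm : Measurable Z := hZe ▸ hX₁m.add hX₂m
  have hanti := cap_anti P ν hm Z hZm
  obtain ⟨R, hR0, hR⟩ : ∃ R : ℝ, 0 ≤ R ∧ ∀ ω, |Z ω| ≤ R := by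
    refine ⟨max (C + D) 0, le_max_right _ _, fun ω => le_trans ?_ (le_max_left _ _)⟩
    rw [hZe]; exact (abs_add_le _ _).trans (add_le_add (hC ω) (hD ω))
  have htop : ∀ x, R ≤ x → ν {ω | x < Z ω} = 0 := by
    intro x hx
    have : {ω | x < Z ω} = ∅ := by
      ext ω; simp; linarith [(abs_le.1 (hR ω)).2]
    rw [this, h0]
  have hbot : ∀ x, x < -R → ν {ω | x < Z ω} = 1 := by
    intro x hx
    have : {ω | x < Z ω} = univ := by
      ext ω; simp; linarith [(abs_le.1 (hR ω)).1]
    rw [this, h1]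
  have hrc : ∀ x, ContinuousWithinAt (fun x => ν {ω | x < Z ω}) (Ici x) x := by
    intro x
    have hU : (⋃ n : ℕ, {ω | x + 1 / ((n:ℝ)+1) < Z ω}) = {ω | x < Z ω} := by
      ext ω
      simp only [mem_iUnion, mem_ofPred_eq]
      constructor
      · rintro ⟨n, hn⟩
        have : (0:ℝ) < 1 / ((n:ℝ)+1) := by positivity
        linarith
      · intro h
        obtain ⟨n, hn⟩ := exists_nat_one_div_lt (sub_pos.2 h)
        exact ⟨n, by linarith⟩
    have ht := hc (fun n : ℕ => {ω | x + 1 / ((n:ℝ)+1) < Z ω})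
      (fun n => measurableSet_lt measurable_const hZm)
      (fun a b hab ω (h : _ < Z ω) => lt_of_le_of_lt (by
        have := Nat.one_div_le_one_div (α := ℝ) hab
        linarith) h)
    rw [hU] at ht
    refine tendsto_order.2 ⟨fun a ha => ?_, fun a ha => ?_⟩
    · obtain ⟨n, hn⟩ := (ht.eventually_const_lt ha).exists
      have : (0:ℝ) < 1 / ((n:ℝ)+1) := by positivity
      filter_upwards [mem_nhdsWithin_of_mem_nhds (Iio_mem_nhds (show x < x + 1 / ((n:ℝ)+1) by linarith))]
        with y hy
      exact hn.trans_le (hanti (le_of_lt hy))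
    · filter_upwards [self_mem_nhdsWithin] with y hy
      exact lt_of_le_of_lt (hanti hy) ha
  let F : StieltjesFunction ℝ :=
    { toFun := fun x => 1 - ν {ω | x < Z ω}
      mono' := fun a b hab => sub_le_sub_left (hanti hab) 1
      right_continuous' := fun x => continuousWithinAt_const.sub (hrc x) }
  have hFtop : Tendsto F atTop (nhds 1) := by
    refine tendsto_const_nhds.congr' ?_
    filter_upwards [eventually_ge_atTop R] with x hx
    change (1:ℝ) = 1 - ν {ω | x < Z ω}
    rw [htop x hx, sub_zero]
  have hFbot : Tendsto F atBot (nhds 0) := by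
    refine tendsto_const_nhds.congr' ?_
    filter_upwards [eventually_lt_atBot (-R)] with x hx
    change (0:ℝ) = 1 - ν {ω | x < Z ω}
    rw [hbot x hx, sub_self]
  let m := F.measure
  have hmp : IsProbabilityMeasure m := F.isProbabilityMeasure hFbot hFtop
  have hnn : ∀ x, 0 ≤ ν {ω | x < Z ω} := fun x => by
    rw [← h0]
    exact hm _ _ MeasurableSet.empty (measurableSet_lt measurable_const hZm)
      (Eventually.of_forall fun ω h => h.elim)
  have hmI : ∀ x, m.real (Ioi x) = ν {ω | x < Z ω} := by
    intro x
    rw [measureReal_def, F.measure_Ioi hFtop]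
    change (ENNReal.ofReal (1 - (1 - ν {ω | x < Z ω}))).toReal = _
    rw [sub_sub_cancel, ENNReal.toReal_ofReal (hnn x)]
  -- key
  have key : ∀ (h : ℝ → ℝ) (L : ℝ), Monotone h → Continuous h → 0 ≤ L → (∀ z, |h z| ≤ L) →
      Integrable h m ∧ chq ν (fun ω => h (Z ω)) = ∫ z, h z ∂m := by
    intro h L hmon hcont hL hb
    have hint : Integrable h m := 
      Integrable.of_bound hcont.aestronglyMeasurable L (Eventually.of_forall hb)
    refine ⟨hint, ?_⟩
    have hsame : ∀ x, ν {ω | x < h (Z ω)} = m.real {z | x < h z} := by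
      intro x
      have := openUpper {z | x < h z} (isOpen_lt continuous_const hcont)
        (fun a b hab (ha : x < h a) => lt_of_lt_of_le ha (hmon hab))
      have e : {ω | x < h (Z ω)} = Z ⁻¹' {z | x < h z} := rfl
      rw [e]
      rcases this with h' | h' | ⟨t, h'⟩
      · simp [h', h0]
      · simp [h', h1]
      · rw [h', hmI]; rfl
    rw [chq_eq P ν h0 h1 hm (fun ω => h (Z ω)) (hcont.measurable.comp hZm) L hL (fun ω => hb (Z ω))]
    have hl := Integrable.integral_eq_integral_meas_lt (μ := m) (f := fun z => h z + L)
      (hint.add (integrable_const L))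
      (Eventually.of_forall fun z => by
        have := (abs_le.1 (hb z)).1
        simp only [Pi.zero_apply]; linarith)
    rw [integral_add hint (integrable_const L)] at hl
    simp only [integral_const, probReal_univ, one_smul] at hl
    rw [eq_sub_of_add_eq hl]
    congr 1
    rw [intervalIntegral.integral_of_le (by linarith)]
    have e2 : ∀ t, m.real {a | t < h a + L} = ν {ω | t - L < h (Z ω)} := by
      intro t
      rw [hsame]; congr 1; ext z; simp [sub_lt_iff_lt_add]
    simp_rw [e2]
    symm
    apply setIntegral_eq_of_subset_of_forall_sdiff_eq_zero measurableSet_Ioi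
      Ioc_subset_Ioi_self
    rintro x ⟨hx, hx'⟩
    simp only [mem_Ioc, mem_Ioi, not_and, not_le] at hx hx'
    have hx2 := hx' hx
    have : {ω | x - L < h (Z ω)} = ∅ := by
      ext ω; simp; linarith [(abs_le.1 (hb (Z ω))).2]
    rw [this, h0]
  -- continuity of f
  have hlip : ∀ f g : ℝ → ℝ, Monotone f → Monotone g → (∀ x, f x + g x = x) → Continuous f := by
    intro f g hf hg hfg
    refine LipschitzWith.continuous (K := 1) (LipschitzWith.of_le_add fun x y => ?_)
    rw [Real.dist_eq]
    rcases le_total x y with h | h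
    · have := hf h; have := abs_nonneg (x - y); linarith
    · have := hg h; have a := hfg x; have b := hfg y; have := le_abs_self (x - y); linarith
  have hc₁ := hlip f₁ f₂ hf₁ hf₂ hf
  have hc₂ := hlip f₂ f₁ hf₂ hf₁ (fun x => by rw [add_comm]; exact hf x)
  let pr : ℝ → ℝ := fun z => max (-R) (min z R)
  have hprm : Monotone pr := fun a b h => max_le_max_left _ (min_le_min_right _ h)
  have hprc : Continuous pr := by fun_prop
  have hprb : ∀ z, -R ≤ pr z ∧ pr z ≤ R := fun z =>
    ⟨le_max_left _ _, max_le (by linarith) (min_le_right _ _)⟩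
  have hprZ : ∀ ω, pr (Z ω) = Z ω := fun ω => by
    have := abs_le.1 (hR ω)
    simp only [pr]
    rw [min_eq_left this.2, max_eq_right this.1]
  have hbd : ∀ f : ℝ → ℝ, Monotone f → Continuous f →
      Integrable (fun z => f (pr z)) m ∧ chq ν (fun ω => f (Z ω)) = ∫ z, f (pr z) ∂m := by
    intro f hf hfc
    have := key (fun z => f (pr z)) (max |f (-R)| |f R|) (hf.comp hprm) (hfc.comp hprc)
      (le_max_of_le_left (abs_nonneg _)) (fun z => by
        exact abs_le_max_abs_abs (hf (hprb z).1) (hf (hprb z).2))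
    simp only [hprZ] at this
    exact this
  have k1 := hbd f₁ hf₁ hc₁
  have k2 := hbd f₂ hf₂ hc₂
  have k3 := hbd (fun z => z) monotone_id continuous_id
  have a1 : X₁ = fun ω => f₁ (Z ω) := funext hZ₁
  have a2 : X₂ = fun ω => f₂ (Z ω) := funext hZ₂
  rw [← hZe, a1, a2, k1.2, k2.2, ← integral_add k1.1 k2.1]
  simp only [hf]
  exact k3.2

/-- `f` is a version of the conditional probability of `A` given `W`. -/
def IsCP {Ω : Type*} [MeasurableSpace Ω] {N : ℕ} (P : Measure Ω) (W : Ω → (Fin N → ℝ))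
    (A : Set Ω) (f : (Fin N → ℝ) → ℝ) : Prop :=
  ∀ S : Set (Fin N → ℝ), MeasurableSet S →
    P (A ∩ W ⁻¹' S) = ∫⁻ w in S, ENNReal.ofReal (f w) ∂(P.map W)

section CP
variable {Ω : Type*} [MeasurableSpace Ω] {N : ℕ} (P : Measure Ω) [IsProbabilityMeasure P]

lemma cp_of_kernel (X : Ω → ℝ) (W : Ω → (Fin N → ℝ)) (K : Kernel (Fin N → ℝ) ℝ)
    (hK : IsCondDistrib P X W K) (x : ℝ) :
    InDstar (fun w => 1 - (K w (Iic x)).toReal) ∧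
      IsCP P W {ω | x < X ω} (fun w => 1 - (K w (Iic x)).toReal) := by
  obtain ⟨hKm, hK⟩ := hK
  have hle : ∀ w, (K w (Iic x)).toReal ≤ 1 := fun w => by
    have := ENNReal.toReal_mono ENNReal.one_ne_top (prob_le_one (μ := K w) (s := Iic x))
    simpa using this
  refine ⟨⟨measurable_const.sub (K.measurable_coe measurableSet_Iic).ennreal_toReal, fun w =>
    ⟨by linarith [hle w], by linarith [ENNReal.toReal_nonneg (a := K w (Iic x))]⟩⟩, ?_⟩
  intro S hS
  have := hK (Ioi x) measurableSet_Ioi S hS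
  refine this.trans ?_
  congr 1
  ext w
  rw [← compl_Iic, prob_compl_eq_one_sub measurableSet_Iic,
    ENNReal.ofReal_sub _ ENNReal.toReal_nonneg, ENNReal.ofReal_one,
    ENNReal.ofReal_toReal (measure_ne_top _ _)]

lemma exists_condDistrib (X : Ω → ℝ) (W : Ω → (Fin N → ℝ)) (hX : Measurable X)
    (hW : Measurable W) : ∃ K, IsCondDistrib P X W K := by
  refine ⟨condDistrib X W P, inferInstance, fun B hB S hS => ?_⟩
  have h := compProd_map_condDistrib (mβ := MeasurableSpace.pi) (μ := P) (X := W) (Y := X) hX.aemeasurable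
  have : IsProbabilityMeasure (P.map W) := Measure.isProbabilityMeasure_map hW.aemeasurable
  rw [← Measure.compProd_apply_prod hS hB, h, Measure.map_apply (hW.prodMk hX) (hS.prod hB)]
  congr 1
  ext ω
  simp [and_comm]

lemma exists_cp (W : Ω → (Fin N → ℝ)) (hW : Measurable W) (A : Set Ω) (hA : MeasurableSet A) :
    ∃ f, InDstar f ∧ IsCP P W A f := by
  obtain ⟨K, hK⟩ := exists_condDistrib P (A.indicator fun _ => (1:ℝ)) W
    (measurable_const.indicator hA) hW
  have := cp_of_kernel P _ W K hK 0
  have e : {ω | 0 < A.indicator (fun _ => (1:ℝ)) ω} = A := by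
    ext ω; by_cases h : ω ∈ A <;> simp [h]
  rw [e] at this
  exact ⟨_, this⟩

lemma cp_mono (W : Ω → (Fin N → ℝ)) (hW : Measurable W) (A B : Set Ω)
    (hAB : ∀ᵐ ω ∂P, ω ∈ A → ω ∈ B) (f g : (Fin N → ℝ) → ℝ)
    (hf : InDstar f) (hg : InDstar g) (hAf : IsCP P W A f) (hBg : IsCP P W B g) :
    ∀ᵐ w ∂(P.map W), f w ≤ g w := by
  have : IsProbabilityMeasure (P.map W) := Measure.isProbabilityMeasure_map hW.aemeasurable
  have h := ae_le_of_forall_setLIntegral_le_of_sigmaFinite (μ := P.map W)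
    (f := fun w => ENNReal.ofReal (f w)) (g := fun w => ENNReal.ofReal (g w))
    hf.1.ennreal_ofReal (fun S hS _ => by
      rw [← hAf S hS, ← hBg S hS]
      refine measure_mono_ae ?_
      filter_upwards [hAB] with ω hω h using ⟨hω h.1, h.2⟩)
  filter_upwards [h] with w hw
  exact (ENNReal.ofReal_le_ofReal_iff (hg.2 w).1).1 hw

lemma cp_iUnion (W : Ω → (Fin N → ℝ)) (hW : Measurable W) (A : ℕ → Set Ω)
    (hA : ∀ n, MeasurableSet (A n)) (hmono : Monotone A) :
    ∃ (f : ℕ → (Fin N → ℝ) → ℝ) (g : (Fin N → ℝ) → ℝ),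
      (∀ n, InDstar (f n) ∧ IsCP P W (A n) (f n)) ∧ InDstar g ∧ IsCP P W (⋃ n, A n) g ∧
      (∀ w, Monotone fun n => f n w) ∧
      (∀ w, Tendsto (fun n => f n w) atTop (nhds (g w))) := by
  choose f0 hf0 hcp using fun n => exists_cp P W hW (A n) (hA n)
  let f : ℕ → (Fin N → ℝ) → ℝ := fun n => n.rec (f0 0) (fun k r w => max (r w) (f0 (k+1) w))
  have hfs : ∀ n w, f (n+1) w = max (f n w) (f0 (n+1) w) := fun n w => rfl
  have hf : ∀ n, InDstar (f n) := by
    intro n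
    induction n with
    | zero => exact hf0 0
    | succ n ih =>
      exact ⟨ih.1.max (hf0 (n+1)).1, fun w => ⟨le_max_of_le_left (ih.2 w).1,
        max_le (ih.2 w).2 ((hf0 (n+1)).2 w).2⟩⟩
  have hae : ∀ n, f n =ᵐ[P.map W] f0 n := by
    intro n
    induction n with
    | zero => exact Eventually.of_forall fun _ => rfl
    | succ n ih =>
      have := cp_mono P W hW (A n) (A (n+1))
        (Eventually.of_forall fun ω h => hmono (Nat.le_succ n) h) _ _ (hf0 n) (hf0 (n+1))
        (hcp n) (hcp (n+1))
      filter_upwards [ih, this] with w h1 h2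
      rw [hfs, h1, max_eq_right h2]
  have hfcp : ∀ n, IsCP P W (A n) (f n) := by
    intro n S hS
    rw [hcp n S hS]
    refine lintegral_congr_ae (ae_restrict_of_ae ?_)
    filter_upwards [hae n] with w hw
    rw [hw]
  have hfm : ∀ w, Monotone fun n => f n w := fun w =>
    monotone_nat_of_le_succ fun n => le_max_left _ _
  have hbdd : ∀ w, BddAbove (range fun n => f n w) := fun w =>
    ⟨1, by rintro _ ⟨n, rfl⟩; exact ((hf n).2 w).2⟩
  have hlim : ∀ w, Tendsto (fun n => f n w) atTop (nhds (⨆ n, f n w)) := fun w =>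
    tendsto_atTop_ciSup (hfm w) (hbdd w)
  refine ⟨f, fun w => ⨆ n, f n w, fun n => ⟨hf n, hfcp n⟩, ⟨?_, fun w => ⟨?_, ?_⟩⟩, ?_, hfm, hlim⟩
  · exact measurable_of_tendsto_metrizable (fun n => (hf n).1) (tendsto_pi_nhds.2 hlim)
  · exact ge_of_tendsto' (hlim w) fun n => ((hf n).2 w).1
  · exact le_of_tendsto' (hlim w) fun n => ((hf n).2 w).2
  · intro S hS
    have t1 : Tendsto (fun n => P (A n ∩ W ⁻¹' S)) atTop (nhds (P (⋃ n, (A n ∩ W ⁻¹' S)))) :=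
      tendsto_measure_iUnion_atTop fun a b h => inter_subset_inter_left _ (hmono h)
    have t2 : Tendsto (fun n => ∫⁻ w in S, ENNReal.ofReal (f n w) ∂(P.map W)) atTop
        (nhds (∫⁻ w in S, ENNReal.ofReal (⨆ n, f n w) ∂(P.map W))) :=
      lintegral_tendsto_of_tendsto_of_monotone
        (fun n => (hf n).1.ennreal_ofReal.aemeasurable)
        (Eventually.of_forall fun w a b h => ENNReal.ofReal_le_ofReal (hfm w h))
        (Eventually.of_forall fun w => (ENNReal.continuous_ofReal.tendsto _).comp (hlim w))
    rw [iUnion_inter]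
    refine tendsto_nhds_unique t1 (t2.congr fun n => ?_)
    rw [hfcp n S hS]

lemma joint_law (A A' : Set Ω) (hA : MeasurableSet A) (hA' : MeasurableSet A')
    (W W' : Ω → (Fin N → ℝ)) (hW : Measurable W) (hW' : Measurable W')
    (hWW : P.map W = P.map W')
    (h : ∀ S, MeasurableSet S → P (A ∩ W ⁻¹' S) = P (A' ∩ W' ⁻¹' S)) :
    (P.map fun ω => (A.indicator (fun _ => (1:ℝ)) ω, W ω)) =
      (P.map fun ω => (A'.indicator (fun _ => (1:ℝ)) ω, W' ω)) := by
  have gen : ∀ (A : Set Ω), MeasurableSet A → ∀ W : Ω → (Fin N → ℝ), Measurable W →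
      ∀ T : Set (ℝ × (Fin N → ℝ)), MeasurableSet T →
      (P.map fun ω => (A.indicator (fun _ => (1:ℝ)) ω, W ω)) T =
        P (A ∩ W ⁻¹' (Prod.mk 1 ⁻¹' T)) +
          (P.map W (Prod.mk 0 ⁻¹' T) - P (A ∩ W ⁻¹' (Prod.mk 0 ⁻¹' T))) := by
    intro A hA W hW T hT
    have hp0 : MeasurableSet (Prod.mk (0:ℝ) ⁻¹' T) := measurable_prodMk_left hT
    rw [Measure.map_apply ((measurable_const.indicator hA).prodMk hW) hT,
      Measure.map_apply hW hp0,
      ← measure_inter_add_sdiff _ hA]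
    congr 1
    · congr 1; ext ω; by_cases hω : ω ∈ A <;> simp [hω]
    · rw [inter_comm, ← measure_inter_add_sdiff (W ⁻¹' (Prod.mk 0 ⁻¹' T)) hA,
        ENNReal.add_sub_cancel_left (measure_ne_top _ _)]
      congr 1; ext ω; by_cases hω : ω ∈ A <;> simp [hω]
  ext T hT
  rw [gen A hA W hW T hT, gen A' hA' W' hW' T hT, hWW,
    h _ (measurable_prodMk_left hT), h _ (measurable_prodMk_left hT)]

end CP

lemma bdd_ind {Ω : Type*} [MeasurableSpace Ω] (A : Set Ω) (hA : MeasurableSet A) :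
    BddRV (A.indicator fun _ => (1:ℝ)) := by
  refine ⟨measurable_const.indicator hA, 1, fun ω => ?_⟩
  by_cases h : ω ∈ A <;> simp [h]

lemma forward {Ω : Type*} [MeasurableSpace Ω] (P : Measure Ω) [IsProbabilityMeasure P]
    (hatomless : Atomless P) {N : ℕ}
    (ρ : (Ω → ℝ) → (Ω → (Fin N → ℝ)) → ℝ)
    (hM : ∀ X Y W, BddRV X → BddRV Y → Measurable W → (∀ᵐ ω ∂P, X ω ≤ Y ω) → ρ X W ≤ ρ Y W)
    (hCA : ∀ X₁ X₂ W, BddRV X₁ → BddRV X₂ → Measurable W → Comonotonic X₁ X₂ →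
        ρ (X₁ + X₂) W = ρ X₁ W + ρ X₂ W)
    (hIC : ∀ (A : ℕ → Set Ω) (Alim : Set Ω), (∀ n, MeasurableSet (A n)) → Monotone A →
        Alim = ⋃ n, A n → ∀ W : Ω → (Fin N → ℝ), Measurable W →
        ρ (Alim.indicator fun _ => 1) W ≤
          liminf (fun n => ρ ((A n).indicator fun _ => 1) W) atTop)
    (hNo : ∀ W : Ω → (Fin N → ℝ), Measurable W → ρ (fun _ => 1) W = 1)
    (hLI : ∀ X X' W W', BddRV X → BddRV X' → Measurable W → Measurable W' →
        (P.map fun ω => (X ω, W ω)) = (P.map fun ω => (X' ω, W' ω)) → ρ X W = ρ X' W') :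
    ∃ G : (Ω → (Fin N → ℝ)) → ((Fin N → ℝ) → ℝ) → ℝ,
      (∀ W, Measurable W → MonotoneFunctional (P.map W) (G W) ∧ ContinuousFromBelow (G W)) ∧
      (∀ W W', Measurable W → Measurable W' → P.map W = P.map W' → G W = G W') ∧
      (∀ X W, BddRV X → Measurable W →
        ∀ K : Kernel (Fin N → ℝ) ℝ, IsCondDistrib P X W K →
          ρ X W = distortionRM (G W) K) := by
  classical
  have hex : ∀ μ : Measure (Fin N → ℝ), ∃ (W : Ω → (Fin N → ℝ)) (U : Ω → ℝ),
      IsProbabilityMeasure μ → (Measurable W ∧ Measurable U ∧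
      P.map (fun ω => (W ω, U ω)) = μ.prod (volume.restrict (Icc (0:ℝ) 1))) := by
    intro μ
    by_cases h : IsProbabilityMeasure μ
    · obtain ⟨W, U, h'⟩ := exists_pair P hatomless μ
      exact ⟨W, U, fun _ => h'⟩
    · exact ⟨fun _ => 0, fun _ => 0, fun h' => absurd h' h⟩
  choose w u hwu using hex
  let Ev : Measure (Fin N → ℝ) → ((Fin N → ℝ) → ℝ) → Set Ω := fun μ f => {ω | u μ ω < f (w μ ω)}
  have hl : IsProbabilityMeasure (volume.restrict (Icc (0:ℝ) 1)) := ⟨by simp⟩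
  have hzero : ∀ W : Ω → (Fin N → ℝ), Measurable W → ρ (fun _ => 0) W = 0 := by
    intro W hW
    have hb : BddRV (fun _ : Ω => (0:ℝ)) := ⟨measurable_const, 0, by simp⟩
    have := hCA (fun _ => 0) (fun _ => 0) W hb hb hW
      ⟨fun _ => 0, fun z => z, fun _ => 0, monotone_id, monotone_const, by simp, by simp, by simp⟩
    have e : ((fun _ => 0 : Ω → ℝ) + fun _ => 0) = fun _ => 0 := by ext; simp
    rw [e] at this; linarith
  have hMi : ∀ A B : Set Ω, MeasurableSet A → MeasurableSet B → ∀ W, Measurable W →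
      (∀ᵐ ω ∂P, ω ∈ A → ω ∈ B) →
      ρ (A.indicator fun _ => 1) W ≤ ρ (B.indicator fun _ => 1) W := by
    intro A B hA hB W hW h
    refine hM _ _ W (bdd_ind A hA) (bdd_ind B hB) hW ?_
    filter_upwards [h] with ω hω
    by_cases h1 : ω ∈ A
    · simp [h1, hω h1]
    · simp only [h1, not_false_eq_true, indicator_of_notMem]
      exact indicator_nonneg (fun _ _ => zero_le_one) ω
  have hemp : ∀ W : Ω → (Fin N → ℝ), Measurable W →
      ρ ((∅ : Set Ω).indicator fun _ => 1) W = 0 := fun W hW => by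
    rw [indicator_empty]; exact hzero W hW
  have huni : ∀ W : Ω → (Fin N → ℝ), Measurable W →
      ρ ((univ : Set Ω).indicator fun _ => 1) W = 1 := fun W hW => by
    rw [indicator_univ]; exact hNo W hW
  refine ⟨fun W f => ρ ((Ev (P.map W) f).indicator fun _ => 1) (w (P.map W)), ?_, ?_, ?_⟩
  · intro W hW
    have hp : IsProbabilityMeasure (P.map W) := Measure.isProbabilityMeasure_map hW.aemeasurable
    obtain ⟨hw, hu, hwum⟩ := hwu (P.map W) hp
    beta_reduce
    generalize P.map W = μ at *
    have hwm : P.map (w μ) = μ := by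
      have : P.map (w μ) = (P.map (fun ω => (w μ ω, u μ ω))).map Prod.fst := by
        rw [Measure.map_map measurable_fst (hw.prodMk hu)]; rfl
      rw [this, hwum, Measure.map_fst_prod]; simp
    have hum : P.map (u μ) = volume.restrict (Icc (0:ℝ) 1) := by
      have : P.map (u μ) = (P.map (fun ω => (w μ ω, u μ ω))).map Prod.snd := by
        rw [Measure.map_map measurable_snd (hw.prodMk hu)]; rfl
      rw [this, hwum, Measure.map_snd_prod]; simp
    have hEm : ∀ f, InDstar f → MeasurableSet (Ev μ f) := fun f hf =>
      measurableSet_lt hu (hf.1.comp hw)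
    have hae : ∀ᵐ ω ∂P, u μ ω ∈ Ico (0:ℝ) 1 := by
      refine ae_of_ae_map hu.aemeasurable ?_
      rw [hum, ← restrict_Ico_eq_restrict_Icc]
      exact ae_restrict_mem measurableSet_Ico
    have d0 : InDstar (fun _ : Fin N → ℝ => (0:ℝ)) := ⟨measurable_const, by simp⟩
    have d1 : InDstar (fun _ : Fin N → ℝ => (1:ℝ)) := ⟨measurable_const, by simp⟩
    have hge : ∀ A : Set Ω, MeasurableSet A → 0 ≤ ρ (A.indicator fun _ => 1) (w μ) := fun A hA => by
      rw [← hemp _ hw]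
      exact hMi _ _ MeasurableSet.empty hA _ hw (Eventually.of_forall fun ω h => h.elim)
    have hle : ∀ A : Set Ω, MeasurableSet A → ρ (A.indicator fun _ => 1) (w μ) ≤ 1 := fun A hA => by
      refine le_of_le_of_eq ?_ (huni _ hw)
      exact hMi _ _ hA MeasurableSet.univ _ hw (Eventually.of_forall fun ω h => mem_univ _)
    refine ⟨⟨fun f hf => ⟨hge _ (hEm f hf), hle _ (hEm f hf)⟩, ?_, ?_, ?_⟩, ?_⟩
    · refine le_antisymm ?_ (hge _ (hEm _ d0))
      refine le_of_le_of_eq ?_ (hemp _ hw)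
      refine hMi _ _ (hEm _ d0) MeasurableSet.empty _ hw ?_
      filter_upwards [hae] with ω hω h
      exact absurd h (not_lt.2 hω.1)
    · refine le_antisymm (hle _ (hEm _ d1)) ?_
      refine le_of_eq_of_le (huni _ hw).symm ?_
      refine hMi _ _ MeasurableSet.univ (hEm _ d1) _ hw ?_
      filter_upwards [hae] with ω hω _
      exact hω.2
    · intro f g hf hg hfg
      refine hMi _ _ (hEm g hg) (hEm f hf) _ hw ?_
      have : ∀ᵐ ω ∂P, g (w μ ω) ≤ f (w μ ω) := by
        refine ae_of_ae_map (p := fun v => g v ≤ f v) hw.aemeasurable ?_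
        rw [hwm]; exact hfg
      filter_upwards [this] with ω hω h
      exact lt_of_lt_of_le h hω
    · intro f g hf hg hfm hfg
      have hmonoE : Monotone fun n => Ev μ (f n) := fun a b hab ω h =>
        lt_of_lt_of_le h (hfm _ hab)
      have hU : Ev μ g = ⋃ n, Ev μ (f n) := by
        ext ω
        simp only [mem_iUnion]
        constructor
        · intro h
          exact ((hfg (w μ ω)).eventually_const_lt h).exists
        · rintro ⟨n, hn⟩
          exact lt_of_lt_of_le hn ((hfm _).ge_of_tendsto (hfg _) n)
      have hI := hIC (fun n => Ev μ (f n)) (Ev μ g) (fun n => hEm _ (hf n)) hmonoE hU (w μ) hw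
      have hub : ∀ n, ρ ((Ev μ (f n)).indicator fun _ => 1) (w μ) ≤
          ρ ((Ev μ g).indicator fun _ => 1) (w μ) := fun n =>
        hMi _ _ (hEm _ (hf n)) (hEm _ hg) _ hw (Eventually.of_forall fun ω h => by
          rw [hU]; exact mem_iUnion.2 ⟨n, h⟩)
      have hbA : IsBoundedUnder (· ≤ ·) atTop
          (fun n => ρ ((Ev μ (f n)).indicator fun _ => 1) (w μ)) :=
        isBoundedUnder_of ⟨_, hub⟩
      have hbB : IsBoundedUnder (· ≥ ·) atTop
          (fun n => ρ ((Ev μ (f n)).indicator fun _ => 1) (w μ)) :=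
        isBoundedUnder_of ⟨0, fun n => hge _ (hEm _ (hf n))⟩
      refine tendsto_of_le_liminf_of_limsup_le hI ?_ hbA hbB
      exact limsup_le_of_le hbB.isCoboundedUnder_le (Eventually.of_forall hub)
  · intro W W' _ _ h
    simp only [h]
  · intro X W hX hW K hK
    have hp : IsProbabilityMeasure (P.map W) := Measure.isProbabilityMeasure_map hW.aemeasurable
    obtain ⟨hw, hu, hwum⟩ := hwu (P.map W) hp
    have hkey : ∀ x : ℝ, ρ ({ω | x < X ω}.indicator fun _ => 1) W =
        ρ ((Ev (P.map W) (fun v => 1 - (K v (Iic x)).toReal)).indicator fun _ => 1)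
          (w (P.map W)) := by
      intro x
      obtain ⟨hD, hcp⟩ := cp_of_kernel P X W K hK x
      generalize hf : (fun v => 1 - (K v (Iic x)).toReal) = f at *
      have hA : MeasurableSet {ω | x < X ω} := measurableSet_lt measurable_const hX.1
      have hE : MeasurableSet (Ev (P.map W) f) := measurableSet_lt hu (hD.1.comp hw)
      refine hLI _ _ W _ (bdd_ind _ hA) (bdd_ind _ hE) hW hw ?_
      have hwm : P.map W = P.map (w (P.map W)) := by
        have : P.map (w (P.map W)) =
            (P.map (fun ω => (w (P.map W) ω, u (P.map W) ω))).map Prod.fst := by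
          rw [Measure.map_map measurable_fst (hw.prodMk hu)]; rfl
        rw [this, hwum, Measure.map_fst_prod]; simp
      refine joint_law P _ _ hA hE _ _ hW hw hwm fun S hS => ?_
      rw [hcp S hS]
      have hT : MeasurableSet {p : (Fin N → ℝ) × ℝ | p.1 ∈ S ∧ p.2 < f p.1} :=
        (measurable_fst hS).inter (measurableSet_lt measurable_snd (hD.1.comp measurable_fst))
      have e : Ev (P.map W) f ∩ w (P.map W) ⁻¹' S =
          (fun ω => (w (P.map W) ω, u (P.map W) ω)) ⁻¹'
            {p : (Fin N → ℝ) × ℝ | p.1 ∈ S ∧ p.2 < f p.1} := by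
        ext ω; exact and_comm
      rw [e, ← Measure.map_apply (hw.prodMk hu) hT, hwum, Measure.prod_apply hT,
        ← lintegral_indicator hS]
      congr 1
      ext v
      by_cases hv : v ∈ S
      · have e2 : Prod.mk v ⁻¹' {p : (Fin N → ℝ) × ℝ | p.1 ∈ S ∧ p.2 < f p.1} = Iio (f v) := by
          ext t; simp [hv]
        rw [e2, indicator_of_mem hv, Measure.restrict_apply measurableSet_Iio]
        have e3 : Iio (f v) ∩ Icc 0 1 = Ico 0 (f v) := by
          ext t
          have := (hD.2 v).2
          simp only [mem_inter_iff, mem_Iio, mem_Icc, mem_Ico]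
          constructor
          · rintro ⟨a, b, c⟩; exact ⟨b, a⟩
          · rintro ⟨a, b⟩; exact ⟨b, a, by linarith⟩
        rw [e3]; simp
      · have e2 : Prod.mk v ⁻¹' {p : (Fin N → ℝ) × ℝ | p.1 ∈ S ∧ p.2 < f p.1} = ∅ := by
          ext t; simp [hv]
        rw [e2, indicator_of_notMem hv]; simp
    rw [greco P (fun X => ρ X W) (fun X Y hX hY => hM X Y W hX hY hW)
      (fun X₁ X₂ h1 h2 => hCA X₁ X₂ W h1 h2 hW) (hNo W hW) X hX]
    simp only [hkey]
    rfl

lemma backward {Ω : Type*} [MeasurableSpace Ω] (P : Measure Ω) [IsProbabilityMeasure P]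
    {N : ℕ} (ρ : (Ω → ℝ) → (Ω → (Fin N → ℝ)) → ℝ)
    (G : (Ω → (Fin N → ℝ)) → ((Fin N → ℝ) → ℝ) → ℝ)
    (hG : ∀ W, Measurable W → MonotoneFunctional (P.map W) (G W) ∧ ContinuousFromBelow (G W))
    (hR : ∀ X W, BddRV X → Measurable W →
        ∀ K : Kernel (Fin N → ℝ) ℝ, IsCondDistrib P X W K →
          ρ X W = distortionRM (G W) K) (W : Ω → (Fin N → ℝ)) (hW : Measurable W) :
    ∃ ν : Set Ω → ℝ, ν ∅ = 0 ∧ ν univ = 1 ∧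
      (∀ A B, MeasurableSet A → MeasurableSet B → (∀ᵐ ω ∂P, ω ∈ A → ω ∈ B) → ν A ≤ ν B) ∧
      (∀ A : ℕ → Set Ω, (∀ n, MeasurableSet (A n)) → Monotone A →
        Tendsto (fun n => ν (A n)) atTop (nhds (ν (⋃ n, A n)))) ∧
      ∀ X, BddRV X → ρ X W = chq ν X := by
  classical
  obtain ⟨⟨hG01, hG0, hG1, hGm⟩, hGc⟩ := hG W hW
  have hp : IsProbabilityMeasure (P.map W) := Measure.isProbabilityMeasure_map hW.aemeasurable
  have hex : ∀ A : Set Ω, ∃ f, MeasurableSet A → InDstar f ∧ IsCP P W A f := by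
    intro A
    by_cases h : MeasurableSet A
    · obtain ⟨f, hf⟩ := exists_cp P W hW A h
      exact ⟨f, fun _ => hf⟩
    · exact ⟨fun _ => 0, fun h' => absurd h' h⟩
  choose cp hcp using hex
  have hmono : ∀ A B, MeasurableSet A → MeasurableSet B → (∀ᵐ ω ∂P, ω ∈ A → ω ∈ B) →
      G W (cp A) ≤ G W (cp B) := by
    intro A B hA hB hAB
    exact hGm _ _ (hcp B hB).1 (hcp A hA).1
      (cp_mono P W hW A B hAB _ _ (hcp A hA).1 (hcp B hB).1 (hcp A hA).2 (hcp B hB).2)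
  have huniq : ∀ A, MeasurableSet A → ∀ f, InDstar f → IsCP P W A f → G W (cp A) = G W f := by
    intro A hA f hf hfA
    have hAA : ∀ᵐ ω ∂P, ω ∈ A → ω ∈ A := Eventually.of_forall fun _ h => h
    exact le_antisymm
      (hGm _ _ hf (hcp A hA).1 (cp_mono P W hW A A hAA _ _ (hcp A hA).1 hf (hcp A hA).2 hfA))
      (hGm _ _ (hcp A hA).1 hf (cp_mono P W hW A A hAA _ _ hf (hcp A hA).1 hfA (hcp A hA).2))
  refine ⟨fun A => G W (cp A), ?_, ?_, hmono, ?_, ?_⟩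
  · dsimp only
    rw [huniq ∅ MeasurableSet.empty (fun _ => 0) ⟨measurable_const, by simp⟩
      (fun S hS => by simp), hG0]
  · dsimp only
    rw [huniq univ MeasurableSet.univ (fun _ => 1) ⟨measurable_const, by simp⟩
      (fun S hS => by simp [Measure.map_apply hW hS]), hG1]
  · intro A hA hAm
    obtain ⟨f, g, hf, hg, hgcp, hfm, hfg⟩ := cp_iUnion P W hW A hA hAm
    have := hGc f g (fun n => (hf n).1) hg hfm hfg
    beta_reduce
    rw [huniq _ (MeasurableSet.iUnion hA) g hg hgcp]
    refine this.congr fun n => ?_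
    rw [huniq _ (hA n) (f n) (hf n).1 (hf n).2]
  · intro X hX
    obtain ⟨K, hK⟩ := exists_condDistrib P X W hX.1 hW
    rw [hR X W hX hW K hK]
    unfold chq distortionRM
    have : ∀ x : ℝ, G W (cp {ω | x < X ω}) = G W (fun w => 1 - (K w (Iic x)).toReal) := fun x =>
      huniq _ (measurableSet_lt measurable_const hX.1) _ (cp_of_kernel P X W K hK x).1
        (cp_of_kernel P X W K hK x).2
    simp only [this]

/-- **Proposition.** `ρ` satisfies M, CA, IC, N and LI iff it is represented by a
law-invariant family of monotone, continuous-from-below functionals `{G_W}`. -/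
theorem stmt4 {Ω : Type*} [MeasurableSpace Ω] (P : Measure Ω) [IsProbabilityMeasure P]
    (hatomless : Atomless P) {N : ℕ} (hN : 1 ≤ N)
    (ρ : (Ω → ℝ) → (Ω → (Fin N → ℝ)) → ℝ) :
    ((∀ X Y W, BddRV X → BddRV Y → Measurable W → (∀ᵐ ω ∂P, X ω ≤ Y ω) → ρ X W ≤ ρ Y W) ∧
     (∀ X₁ X₂ W, BddRV X₁ → BddRV X₂ → Measurable W → Comonotonic X₁ X₂ →
        ρ (X₁ + X₂) W = ρ X₁ W + ρ X₂ W) ∧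
     -- IC : indicator lower semicontinuity
     (∀ (A : ℕ → Set Ω) (Alim : Set Ω), (∀ n, MeasurableSet (A n)) → Monotone A →
        Alim = ⋃ n, A n → ∀ W : Ω → (Fin N → ℝ), Measurable W →
        ρ (Alim.indicator fun _ => 1) W ≤
          liminf (fun n => ρ ((A n).indicator fun _ => 1) W) atTop) ∧
     (∀ W : Ω → (Fin N → ℝ), Measurable W → ρ (fun _ => 1) W = 1) ∧
     (∀ X X' W W', BddRV X → BddRV X' → Measurable W → Measurable W' →
        (P.map fun ω => (X ω, W ω)) = (P.map fun ω => (X' ω, W' ω)) → ρ X W = ρ X' W'))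
    ↔
    ∃ G : (Ω → (Fin N → ℝ)) → ((Fin N → ℝ) → ℝ) → ℝ,
      (∀ W, Measurable W → MonotoneFunctional (P.map W) (G W) ∧ ContinuousFromBelow (G W)) ∧
      (∀ W W', Measurable W → Measurable W' → P.map W = P.map W' → G W = G W') ∧
      (∀ X W, BddRV X → Measurable W →
        ∀ K : Kernel (Fin N → ℝ) ℝ, IsCondDistrib P X W K →
          ρ X W = distortionRM (G W) K) := by

  constructor
  · rintro ⟨hM, hCA, hIC, hNo, hLI⟩
    exact forward P hatomless ρ hM hCA hIC hNo hLI
  · rintro ⟨G, hG, hGL, hR⟩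
    have hb := backward P ρ G hG hR
    refine ⟨?_, ?_, ?_, ?_, ?_⟩
    · intro X Y W hX hY hW hXY
      obtain ⟨ν, h0, h1, hm, hc, hr⟩ := hb W hW
      rw [hr X hX, hr Y hY]
      exact chq_mono P ν h0 h1 hm X Y hX hY hXY
    · intro X₁ X₂ W hX hY hW hco
      obtain ⟨ν, h0, h1, hm, hc, hr⟩ := hb W hW
      have hs : BddRV (X₁ + X₂) := by
        obtain ⟨hX, C, hC⟩ := hX
        obtain ⟨hY, D, hD⟩ := hY
        exact ⟨hX.add hY, C + D, fun ω => (abs_add_le _ _).trans (add_le_add (hC ω) (hD ω))⟩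
      rw [hr _ hX, hr _ hY, hr _ hs]
      exact chq_CA P ν h0 h1 hm hc X₁ X₂ hX hY hco
    · intro A Alim hA hAm hlim W hW
      obtain ⟨ν, h0, h1, hm, hc, hr⟩ := hb W hW
      have hv : ∀ A, MeasurableSet A → ρ (A.indicator fun _ => 1) W = ν A := fun A hA => by
        rw [hr _ (bdd_ind A hA), chq_indicator ν h0 h1]
      have hAl : MeasurableSet Alim := hlim ▸ MeasurableSet.iUnion hA
      simp only [hv _ hAl, hv _ (hA _)]
      have := hc A hA hAm
      rw [← hlim] at this
      exact this.liminf_eq.ge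
    · intro W hW
      obtain ⟨ν, h0, h1, hm, hc, hr⟩ := hb W hW
      have := chq_indicator ν h0 h1 univ
      rw [h1, ← hr _ (bdd_ind univ MeasurableSet.univ), indicator_univ] at this
      exact this
    · intro X X' W W' hX hX' hW hW' hl
      have hWW : P.map W = P.map W' := by
        have h1 : P.map W = (P.map fun ω => (X ω, W ω)).map Prod.snd := by
          rw [Measure.map_map measurable_snd (hX.1.prodMk hW)]; rfl
        have h2 : P.map W' = (P.map fun ω => (X' ω, W' ω)).map Prod.snd := by
          rw [Measure.map_map measurable_snd (hX'.1.prodMk hW')]; rfl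
        rw [h1, h2, hl]
      obtain ⟨K, hK⟩ := exists_condDistrib P X W hX.1 hW
      have hK' : IsCondDistrib P X' W' K := by
        refine ⟨hK.1, fun B hB S hS => ?_⟩
        rw [← hWW, ← hK.2 B hB S hS]
        have e1 : {ω | X ω ∈ B} ∩ W ⁻¹' S = (fun ω => (X ω, W ω)) ⁻¹' (B ×ˢ S) := rfl
        have e2 : {ω | X' ω ∈ B} ∩ W' ⁻¹' S = (fun ω => (X' ω, W' ω)) ⁻¹' (B ×ˢ S) := rfl
        rw [e1, e2, ← Measure.map_apply (hX.1.prodMk hW) (hB.prod hS),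
          ← Measure.map_apply (hX'.1.prodMk hW') (hB.prod hS), hl]
      rw [hR X W hX hW K hK, hR X' W' hX' hW' K hK', hGL W W' hW hW' hWW]
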